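/- Let H0 be a hierarchy on [n] with induced triplet set T0, and let H1 be any hierarchy on [n] whose induced triplet set T1 differs from T0. Then Trev(H0, T0) > Trev(H0, T1); that is, among all triplet sets induced by hierarchies on [n], T0 is the unique maximizer of T ↦ Trev(H0, T). -/

import Mathlib

open Finset MeasureTheory

namespace CompHC

/-- A rooted binary tree with leaves labelled by elements of `Fin n`. -/
inductive HTree (n : ℕ) : Type
  | leaf (i : Fin n) : HTree n
  | node (l r : HTree n) : HTree n

namespace HTree

/-- The list of leaf labels of a tree. -/
def leaves {n : ℕ} : HTree n → List (Fin n)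
  | .leaf i => [i]
  | .node l r => l.leaves ++ r.leaves

/-- The number of leaves of a tree. -/
def size {n : ℕ} (t : HTree n) : ℕ := t.leaves.length

/-- `|H(i ∨ j)|`: the number of leaves of the smallest subtree containing both `i` and `j`. -/
def lcaSize {n : ℕ} : HTree n → Fin n → Fin n → ℕ
  | .leaf _, _, _ => 1
  | .node l r, i, j =>
      if i ∈ l.leaves ∧ j ∈ l.leaves then l.lcaSize i j
      else if i ∈ r.leaves ∧ j ∈ r.leaves then r.lcaSize i j
      else l.size + r.size

/-- Sum of `f |N1| |N2|` over the internal nodes `N` of the tree, `N1, N2` its children. -/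
def internalSum {n : ℕ} (f : ℕ → ℕ → ℕ) : HTree n → ℕ
  | .leaf _ => 0
  | .node l r => f l.size r.size + l.internalSum f + r.internalSum f

end HTree

/-- A hierarchy on `[n]`: every object appears exactly once as a leaf. -/
def IsHierarchy {n : ℕ} (t : HTree n) : Prop :=
  t.leaves.Nodup ∧ ∀ i : Fin n, i ∈ t.leaves

abbrev Triplet (n : ℕ) := Fin n × Fin n × Fin n
abbrev Quadruplet (n : ℕ) := Fin n × Fin n × Fin n × Fin n

/-- The entries of a triplet are pairwise distinct. -/
def distinctTriplet {n : ℕ} (t : Triplet n) : Prop :=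
  t.1 ≠ t.2.1 ∧ t.1 ≠ t.2.2 ∧ t.2.1 ≠ t.2.2

/-- A quadruplet `(i,j,k,l)` satisfies `i<j`, `k<l`, `(i,j) ≠ (k,l)`. -/
def validQuadruplet {n : ℕ} (q : Quadruplet n) : Prop :=
  q.1 < q.2.1 ∧ q.2.2.1 < q.2.2.2 ∧ (q.1, q.2.1) ≠ (q.2.2.1, q.2.2.2)

/-- Triplet revenue `Trev(H,T) = Σ_{(i,j,k)∈T} (|H(i∨k)| − |H(i∨j)|)`. -/
def Trev {n : ℕ} (H : HTree n) (T : Finset (Triplet n)) : ℤ :=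
  ∑ t ∈ T, ((H.lcaSize t.1 t.2.2 : ℤ) - (H.lcaSize t.1 t.2.1 : ℤ))

/-- Quadruplet revenue `Qrev(H,Q) = Σ_{(i,j,k,l)∈Q} (|H(k∨l)| − |H(i∨j)|)`. -/
def Qrev {n : ℕ} (H : HTree n) (Q : Finset (Quadruplet n)) : ℤ :=
  ∑ q ∈ Q, ((H.lcaSize q.2.2.1 q.2.2.2 : ℤ) - (H.lcaSize q.1 q.2.1 : ℤ))

/-- The set of pairs `(i,j)` with `i < j`. -/
def pairs (n : ℕ) : Finset (Fin n × Fin n) :=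
  Finset.univ.filter fun p => p.1 < p.2

/-- Dasgupta's cost `Dcost(H,s) = Σ_{i<j} s_{ij}·|H(i∨j)|`. -/
noncomputable def Dcost {n : ℕ} (H : HTree n) (s : Fin n → Fin n → ℝ) : ℝ :=
  ∑ p ∈ pairs n, s p.1 p.2 * (H.lcaSize p.1 p.2 : ℝ)

/-- The AddS3 similarity computed from a triplet set. -/
def sAddS3 {n : ℕ} (T : Finset (Triplet n)) (i j : Fin n) : ℤ :=
  ∑ k ∈ Finset.univ.filter (fun k : Fin n => k ≠ i ∧ k ≠ j),
    (((if (i, j, k) ∈ T then 1 else 0) - (if (i, k, j) ∈ T then 1 else 0)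
      + (if (j, i, k) ∈ T then 1 else 0) - (if (j, k, i) ∈ T then 1 else 0) : ℤ))

/-- The AddS4 similarity computed from a quadruplet set. -/
def sAddS4 {n : ℕ} (Q : Finset (Quadruplet n)) (i j : Fin n) : ℤ :=
  ∑ p ∈ (pairs n).filter (fun p => p ≠ (i, j)),
    (((if (i, j, p.1, p.2) ∈ Q then 1 else 0)
      - (if (p.1, p.2, i, j) ∈ Q then 1 else 0) : ℤ))

/-- The triplet set induced by a hierarchy `H0`:
`T0 = {(i,j,k) : i,j,k pairwise distinct, |H0(i∨j)| < min(|H0(i∨k)|, |H0(j∨k)|)}`. -/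
def inducedTriplets {n : ℕ} (H : HTree n) : Finset (Triplet n) :=
  Finset.univ.filter fun t : Triplet n =>
    t.1 ≠ t.2.1 ∧ t.1 ≠ t.2.2 ∧ t.2.1 ≠ t.2.2 ∧
    H.lcaSize t.1 t.2.1 < min (H.lcaSize t.1 t.2.2) (H.lcaSize t.2.1 t.2.2)


namespace HTree

theorem size_pos {n : ℕ} (t : HTree n) : 0 < t.size := by
  induction t with
  | leaf i => simp [size, leaves]
  | node l r hl hr => simp only [size, leaves, List.length_append] at *; omega

theorem lcaSize_le_size {n : ℕ} (t : HTree n) (i j : Fin n) : t.lcaSize i j ≤ t.size := by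
  induction t with
  | leaf i => simp [size, leaves, lcaSize]
  | node l r hl hr =>
    have h : (node l r).size = l.size + r.size := by simp [size, leaves]
    rw [lcaSize]
    split_ifs <;> omega

theorem lcaSize_comm {n : ℕ} (t : HTree n) (i j : Fin n) : t.lcaSize i j = t.lcaSize j i := by
  induction t with
  | leaf i => rfl
  | node l r hl hr =>
    simp only [lcaSize, hl, hr, and_comm]

/-- Among three leaves, not all equal, one pair joins strictly below the common join of the other
two pairs. -/
theorem lcaSize_trichotomy {n : ℕ} (t : HTree n) (ht : t.leaves.Nodup) {i j k : Fin n}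
    (hi : i ∈ t.leaves) (hj : j ∈ t.leaves) (hk : k ∈ t.leaves)
    (hij : i ≠ j) :
    (t.lcaSize i j < t.lcaSize i k ∧ t.lcaSize i k = t.lcaSize j k) ∨
    (t.lcaSize i k < t.lcaSize i j ∧ t.lcaSize i j = t.lcaSize j k) ∨
    (t.lcaSize j k < t.lcaSize i j ∧ t.lcaSize i j = t.lcaSize i k) := by
  induction t with
  | leaf a =>
    simp only [leaves, List.mem_singleton] at hi hj
    exact absurd (hi.trans hj.symm) hij
  | node l r hl hr =>
    rw [leaves, List.nodup_append] at ht
    obtain ⟨hln, hrn, hd⟩ := ht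
    have hdis : ∀ a, a ∈ l.leaves → a ∉ r.leaves := fun a ha hb => hd a ha a hb rfl
    simp only [leaves, List.mem_append] at hi hj hk
    have hlp := l.size_pos
    have hrp := r.size_pos
    have hle := l.lcaSize_le_size
    have hre := r.lcaSize_le_size
    have h1 := hle i j
    have h2 := hle i k
    have h3 := hle j k
    have h4 := hre i j
    have h5 := hre i k
    have h6 := hre j k
    have hl' := hl hln
    have hr' := hr hrn
    have di := hdis i
    have dj := hdis j
    have dk := hdis k
    clear hl hr hd hdis hle hre hln hrn
    by_cases ai : i ∈ l.leaves <;> by_cases aj : j ∈ l.leaves <;>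
      by_cases ak : k ∈ l.leaves <;>
      simp only [ai, aj, ak, true_or, false_or, forall_const,
        false_imp_iff] at hi hj hk di dj dk hl' hr' <;>
      simp_all [lcaSize] <;> omega

end HTree

theorem mem_inducedTriplets {n : ℕ} (H : HTree n) (i j k : Fin n) :
    (i, j, k) ∈ inducedTriplets H ↔ i ≠ j ∧ i ≠ k ∧ j ≠ k ∧
      H.lcaSize i j < H.lcaSize i k ∧ H.lcaSize i j < H.lcaSize j k := by
  simp [inducedTriplets]

/-- The contribution of `(i, j, k)` to the triplet revenue. -/
def tripletTerm {n : ℕ} (H : HTree n) (T : Finset (Triplet n)) (i j k : Fin n) : ℤ :=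
  if (i, j, k) ∈ T then (H.lcaSize i k : ℤ) - H.lcaSize i j else 0

theorem Trev_eq_sum {n : ℕ} (H : HTree n) (T : Finset (Triplet n)) :
    Trev H T = ∑ i, ∑ j, ∑ k, tripletTerm H T i j k := by
  simp only [tripletTerm, ← Fintype.sum_prod_type', Trev]
  rw [← Finset.sum_filter]
  congr 1
  ext ⟨i, j, k⟩
  simp

/-- The contribution of all six orderings of `(i, j, k)` to the triplet revenue. -/
def symmTripletTerm {n : ℕ} (H : HTree n) (T : Finset (Triplet n)) (i j k : Fin n) : ℤ :=
  tripletTerm H T i j k + tripletTerm H T j i k + tripletTerm H T i k j +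
    tripletTerm H T k i j + tripletTerm H T j k i + tripletTerm H T k j i

theorem six_mul_Trev {n : ℕ} (H : HTree n) (T : Finset (Triplet n)) :
    6 * Trev H T = ∑ i, ∑ j, ∑ k, symmTripletTerm H T i j k := by
  have swap₁ (f : Fin n → Fin n → Fin n → ℤ) :
      ∑ i, ∑ j, ∑ k, f j i k = ∑ i, ∑ j, ∑ k, f i j k := Finset.sum_comm
  have swap₂ (f : Fin n → Fin n → Fin n → ℤ) :
      ∑ i, ∑ j, ∑ k, f i k j = ∑ i, ∑ j, ∑ k, f i j k :=
    Finset.sum_congr rfl fun _ _ => Finset.sum_comm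
  have h₁ := swap₁ (tripletTerm H T)
  have h₂ := swap₂ (tripletTerm H T)
  have h₃ := swap₂ fun i j k => tripletTerm H T j i k
  have h₄ := swap₁ fun i j k => tripletTerm H T i k j
  have h₅ := swap₁ fun i j k => tripletTerm H T k i j
  rw [Trev_eq_sum]
  simp only [symmTripletTerm, Finset.sum_add_distrib]
  linarith

theorem symmTripletTerm_of_not_distinct {n : ℕ} (H H' : HTree n) {i j k : Fin n}
    (h : ¬ (i ≠ j ∧ i ≠ k ∧ j ≠ k)) :
    symmTripletTerm H (inducedTriplets H') i j k = 0 := by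
  have hzero (a b c : Fin n) (h : ¬ (a ≠ b ∧ a ≠ c ∧ b ≠ c)) :
      tripletTerm H (inducedTriplets H') a b c = 0 :=
    if_neg fun hm => h (by rw [mem_inducedTriplets] at hm; tauto)
  simp only [symmTripletTerm]
  rw [hzero i j k, hzero j i k, hzero i k j, hzero k i j, hzero j k i, hzero k j i] <;>
    first | rfl | (simp only [ne_comm, ne_eq] at *; tauto)

theorem symmTripletTerm_lt_or_mem_iff {n : ℕ} {H0 H1 : HTree n}
    (hH0 : IsHierarchy H0) (hH1 : IsHierarchy H1) (i j k : Fin n) :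
    symmTripletTerm H0 (inducedTriplets H1) i j k <
        symmTripletTerm H0 (inducedTriplets H0) i j k ∨
      symmTripletTerm H0 (inducedTriplets H1) i j k =
          symmTripletTerm H0 (inducedTriplets H0) i j k ∧
        ((i, j, k) ∈ inducedTriplets H1 ↔ (i, j, k) ∈ inducedTriplets H0) := by
  by_cases h : i ≠ j ∧ i ≠ k ∧ j ≠ k
  · obtain ⟨hij, hik, hjk⟩ := h
    have e₀ := H0.lcaSize_trichotomy hH0.1 (hH0.2 i) (hH0.2 j) (hH0.2 k) hij
    have e₁ := H1.lcaSize_trichotomy hH1.1 (hH1.2 i) (hH1.2 j) (hH1.2 k) hij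
    simp only [symmTripletTerm, tripletTerm, mem_inducedTriplets, H0.lcaSize_comm j i,
      H0.lcaSize_comm k i, H0.lcaSize_comm k j, H1.lcaSize_comm j i,
      H1.lcaSize_comm k i, H1.lcaSize_comm k j, ne_eq, hij, hik, hjk, hij.symm, hik.symm,
      hjk.symm, not_false_eq_true, true_and]
    generalize H0.lcaSize i j = a at *
    generalize H0.lcaSize i k = b at *
    generalize H0.lcaSize j k = c at *
    generalize H1.lcaSize i j = x at *
    generalize H1.lcaSize i k = y at *
    generalize H1.lcaSize j k = z at *
    rcases e₀ with ⟨h, rfl⟩ | ⟨h, rfl⟩ | ⟨h, rfl⟩ <;>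
      rcases e₁ with ⟨h', rfl⟩ | ⟨h', rfl⟩ | ⟨h', rfl⟩ <;>
      simp only [h, h', h.not_gt, h'.not_gt, lt_irrefl, and_true, and_self,
        if_true, if_false] <;>
      first | omega | simp
  · refine Or.inr ⟨?_, ?_⟩
    · rw [symmTripletTerm_of_not_distinct H0 H1 h, symmTripletTerm_of_not_distinct H0 H0 h]
    · simp only [mem_inducedTriplets]
      tauto

/-- Among triplet sets induced by hierarchies, `T0` is the unique maximizer of
`T ↦ Trev(H0, T)`: if `T1 ≠ T0` then `Trev(H0, T0) > Trev(H0, T1)`. -/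
theorem induced_triplets_unique_maximizer {n : ℕ} (H0 H1 : HTree n)
    (hH0 : IsHierarchy H0) (hH1 : IsHierarchy H1)
    (hne : inducedTriplets H1 ≠ inducedTriplets H0) :
    Trev H0 (inducedTriplets H0) > Trev H0 (inducedTriplets H1) := by
  have hle (i j k : Fin n) : symmTripletTerm H0 (inducedTriplets H1) i j k ≤
      symmTripletTerm H0 (inducedTriplets H0) i j k :=
    (symmTripletTerm_lt_or_mem_iff hH0 hH1 i j k).elim le_of_lt fun h => h.1.le
  obtain ⟨i, j, k, hlt⟩ : ∃ i j k, symmTripletTerm H0 (inducedTriplets H1) i j k <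
      symmTripletTerm H0 (inducedTriplets H0) i j k := by
    by_contra! hge
    refine hne (Finset.ext fun ⟨i, j, k⟩ => ?_)
    exact ((symmTripletTerm_lt_or_mem_iff hH0 hH1 i j k).resolve_left (hge i j k).not_gt).2
  have hsum : 6 * Trev H0 (inducedTriplets H1) < 6 * Trev H0 (inducedTriplets H0) := by
    rw [six_mul_Trev, six_mul_Trev]
    refine Finset.sum_lt_sum (fun i _ => Finset.sum_le_sum fun j _ =>
      Finset.sum_le_sum fun k _ => hle i j k) ⟨i, Finset.mem_univ _, ?_⟩
    refine Finset.sum_lt_sum (fun j _ => Finset.sum_le_sum fun k _ => hle i j k)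
      ⟨j, Finset.mem_univ _, ?_⟩
    exact Finset.sum_lt_sum (fun k _ => hle i j k) ⟨k, Finset.mem_univ _, hlt⟩
  linarith

end CompHC
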